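/- arXiv:1309.2682 — 3 statements merged into one kernel-verified Lean document; each statement's English description precedes it below -/
import Mathlib

section
/- For every computable function g : ℕ → ℕ, one has g(n) < h_{ω₁}(n) for every sufficiently large positive integer n; that is, h_{ω₁} dominates all computable functions. -/
/-- `hOmega1 n` is the smallest `b` such that for each polynomial
`D(x, x_1, ..., x_i) ∈ B_{ω₁}(n)` (total degree `≤ n`, coefficients in `[-n, n]`,
`i ≤ n`, and for each non-negative integer `j` the equation `D(j, x_1, ..., x_i) = 0`
has at least one solution in non-negative integers), the equation
`D(n, x_1, ..., x_i) = 0` has a solution in non-negative integers all not greater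
than `b`. -/
noncomputable def hOmega1 (n : ℕ) : ℕ :=
  sInf {b : ℕ | ∀ i : ℕ, i ≤ n → ∀ D : MvPolynomial (Fin (i + 1)) ℤ,
    D.totalDegree ≤ n →
    (∀ m : Fin (i + 1) →₀ ℕ, |MvPolynomial.coeff m D| ≤ (n : ℤ)) →
    (∀ j : ℕ, ∃ x : Fin i → ℕ,
      MvPolynomial.eval (Fin.cons (j : ℤ) (fun t => (x t : ℤ))) D = 0) →
    ∃ x : Fin i → ℕ,
      MvPolynomial.eval (Fin.cons (n : ℤ) (fun t => (x t : ℤ))) D = 0 ∧ ∀ t, x t ≤ b}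

namespace DPRM

open Nat in
theorem digits_sum_lt (u : ℕ) (c : ℕ → ℕ) (hc : ∀ i, c i < u) (k : ℕ) :
    ∑ i ∈ Finset.range k, c i * u ^ i < u ^ k := by
  induction k with
  | zero => simp
  | succ k ih =>
    rw [Finset.sum_range_succ, pow_succ]
    have h1 : (c k + 1) * u ^ k ≤ u * u ^ k := Nat.mul_le_mul_right _ (hc k)
    nlinarith

theorem choose_eq (n k : ℕ) :
    n.choose k = ((1 + (2 ^ n + 1)) ^ n / (2 ^ n + 1) ^ k) % (2 ^ n + 1) := by
  set u := 2 ^ n + 1 with hu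
  have hc : ∀ i, n.choose i < u := fun i => by
    have := Nat.choose_le_two_pow n i
    omega
  have hu0 : 0 < u := Nat.succ_pos _
  have key : (1 + u) ^ n = (∑ i ∈ Finset.range k, n.choose i * u ^ i)
      + u ^ k * (n.choose k + u * ∑ i ∈ Finset.range n, n.choose (k + 1 + i) * u ^ i) := by
    have h1 : (1 + u) ^ n = ∑ i ∈ Finset.range (k + 1 + n), n.choose i * u ^ i := by
      rw [add_comm 1 u, add_pow]
      refine (Finset.sum_congr rfl (g := fun m => n.choose m * u ^ m)
        fun i _ => by simp [mul_comm]).trans ?_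
      apply Finset.sum_subset
      · intro i; simp only [Finset.mem_range]; omega
      · intro i _ hi
        simp only [Finset.mem_range, not_lt] at hi
        rw [Nat.choose_eq_zero_of_lt (by omega)]; simp
    rw [h1, Finset.sum_range_add, Finset.sum_range_succ, mul_add, add_assoc]
    congr 1
    congr 1
    · ring
    · rw [← mul_assoc, Finset.mul_sum]
      exact Finset.sum_congr rfl fun i _ => by ring
  rw [key, Nat.add_mul_div_left _ _ (pow_pos hu0 k),
    Nat.div_eq_of_lt (digits_sum_lt u _ hc k), zero_add, Nat.add_mul_mod_self_left,
    Nat.mod_eq_of_lt (hc k)]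

theorem descFactorial_bound (r k : ℕ) (hk : k ≤ r) :
    r ^ (k + 1) ≤ r * r.descFactorial k + k * k * r ^ k := by
  induction k with
  | zero => simp
  | succ k ih =>
    have ih := ih (by omega)
    rw [Nat.descFactorial_succ]
    obtain ⟨d, rfl⟩ : ∃ d, r = k + d := ⟨r - k, by omega⟩
    have h1 := Nat.descFactorial_le_pow (k + d) k
    rw [Nat.add_sub_cancel_left]
    generalize (k + d).descFactorial k = D at *
    have h2 : (k + d) ^ (k + 1 + 1) ≤ (k + d) * ((k + d) * D + k * k * (k + d) ^ k) := by
      rw [pow_succ']; exact Nat.mul_le_mul_left _ ih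
    refine h2.trans ?_
    have h3 : k * (k + d) * D ≤ k * (k + d) * (k + d) ^ k := Nat.mul_le_mul_left _ h1
    rw [pow_succ]
    generalize (k + d) ^ k = E at *
    nlinarith [Nat.zero_le (k * (k + d) * E), Nat.zero_le ((k + d) * E)]

theorem factorial_eq (n : ℕ) :
    n.factorial = ((n ^ n + 1) * (n * n) + 1) ^ n / ((n ^ n + 1) * (n * n) + 1).choose n := by
  set r := (n ^ n + 1) * (n * n) + 1 with hr
  have hnr : n ≤ r := by
    have : n * 1 ≤ n * n := by
      rcases Nat.eq_zero_or_pos n with h | h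
      · simp [h]
      · exact Nat.mul_le_mul_left _ h
    nlinarith [Nat.zero_le (n ^ n * (n * n))]
  have hb := descFactorial_bound r n hnr
  have hle := Nat.descFactorial_le_pow r n
  rw [Nat.descFactorial_eq_factorial_mul_choose] at hb hle
  have hf : n.factorial ≤ n ^ n := Nat.factorial_le_pow n
  have hf0 := Nat.factorial_pos n
  have hr0 : 0 < r := by omega
  have hp : 0 < r ^ n := pow_pos hr0 n
  symm
  apply Nat.div_eq_of_lt_le
  · exact hle
  · have h1 : (n.factorial + 1) * (n * n) < r := by
      have : (n.factorial + 1) * (n * n) ≤ (n ^ n + 1) * (n * n) :=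
        Nat.mul_le_mul_right _ (by omega)
      omega
    have h2 : (n.factorial + 1) * (n * n) * r ^ n < r * r ^ n :=
      Nat.mul_lt_mul_of_pos_right h1 hp
    have h3 := Nat.mul_le_mul_left (n.factorial + 1) hb
    have h4 : (n.factorial * r) * r ^ n < (n.factorial * r) * ((n.factorial + 1) * r.choose n) := by
      rw [pow_succ] at h3
      nlinarith
    exact Nat.lt_of_mul_lt_mul_left h4

section core

variable {y Q N : ℕ}

theorem factor_eq (hy : y ≤ Q) (hN : N + 1 = Q.factorial * Q.factorial) {k : ℕ} (hk : k < y) :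
    ∃ w, (k + 1) * (w * Q.factorial) = N + 1 := by
  obtain ⟨w, hw⟩ := Nat.dvd_factorial (Nat.succ_pos k) (show k + 1 ≤ Q by omega)
  exact ⟨w, by rw [hN]; nth_rw 2 [hw]; rw [Nat.succ_eq_add_one]; ring⟩

/-- the moduli -/
def md (N k : ℕ) : ℕ := (N + 1) / (k + 1) - 1

theorem md_spec (hy : y ≤ Q) (hN : N + 1 = Q.factorial * Q.factorial) {k : ℕ} (hk : k < y) :
    (k + 1) * md N k + k = N ∧ ∃ w, 0 < w ∧ md N k + 1 = w * Q.factorial := by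
  obtain ⟨w, hw⟩ := factor_eq hy hN hk
  have h1 : (N + 1) / (k + 1) = w * Q.factorial := by
    rw [← hw]; exact Nat.mul_div_cancel_left _ (Nat.succ_pos k)
  have hw0 : 0 < w := by
    rcases Nat.eq_zero_or_pos w with h | h
    · subst h; simp at hw
    · exact h
  have h2 : 0 < w * Q.factorial := Nat.mul_pos hw0 (Nat.factorial_pos Q)
  have h3 : md N k + 1 = w * Q.factorial := by unfold md; omega
  refine ⟨?_, w, hw0, h3⟩
  rw [← h3] at hw
  nlinarith

theorem prime_gt (hy : y ≤ Q) (hN : N + 1 = Q.factorial * Q.factorial) {k : ℕ} (hk : k < y)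
    {p : ℕ} (hp : p.Prime) (hd : p ∣ md N k) : Q < p := by
  by_contra hlt
  push Not at hlt
  obtain ⟨-, w, -, hw⟩ := md_spec hy hN hk
  have h1 : p ∣ md N k + 1 := by
    rw [hw]; exact Dvd.dvd.mul_left (Nat.dvd_factorial hp.pos hlt) _
  have := (Nat.dvd_add_right hd).1 h1
  exact hp.one_lt.ne' (Nat.dvd_one.1 this)

theorem md_coprime (hy : y ≤ Q) (hN : N + 1 = Q.factorial * Q.factorial) {k l : ℕ} (hk : k < y)
    (hl : l < y) (hkl : k ≠ l) : Nat.Coprime (md N k) (md N l) := by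
  apply Nat.Coprime.symm
  apply Nat.coprime_of_dvd
  intro p hp h1 h2
  have hQ := prime_gt hy hN hk hp h2
  have e1 := (md_spec hy hN hk).1
  have e2 := (md_spec hy hN hl).1
  have d1 : (p : ℤ) ∣ (N : ℤ) - k := by
    have : (N : ℤ) - k = (k + 1) * (md N k : ℤ) := by rw [← e1]; push_cast; rw [e1]; ring
    rw [this]; exact Dvd.dvd.mul_left (by exact_mod_cast h2) _
  have d2 : (p : ℤ) ∣ (N : ℤ) - l := by
    have : (N : ℤ) - l = (l + 1) * (md N l : ℤ) := by rw [← e2]; push_cast; rw [e2]; ring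
    rw [this]; exact Dvd.dvd.mul_left (by exact_mod_cast h1) _
  have d3 : (p : ℤ) ∣ (k : ℤ) - l := by
    have := dvd_sub d2 d1
    simpa using this
  have := Int.eq_zero_of_abs_lt_dvd d3 (by rw [abs_lt]; constructor <;> omega)
  omega

theorem prod_md (hy : y ≤ Q) (hN : N + 1 = Q.factorial * Q.factorial) :
    ∏ k ∈ Finset.range y, md N k = N.choose y := by
  have h : ∀ z ≤ y, z.factorial * ∏ k ∈ Finset.range z, md N k = N.descFactorial z := by
    intro z
    induction z with
    | zero => simp
    | succ z ih =>
      intro hz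
      have := (md_spec hy hN (show z < y by omega)).1
      rw [Finset.prod_range_succ, Nat.descFactorial_succ, ← ih (by omega), Nat.factorial_succ,
        show N - z = (z + 1) * md N z by omega]
      ring
  have h1 := h y le_rfl
  rw [Nat.descFactorial_eq_factorial_mul_choose] at h1
  exact Nat.eq_of_mul_eq_mul_left (Nat.factorial_pos y) h1

theorem prime_dvd_choose {p a u : ℕ} (hp : p.Prime) (h : p ∣ a.choose (u + 1)) :
    ∃ j ≤ u, (p : ℤ) ∣ (a : ℤ) - j := by
  by_cases hau : a ≤ u
  · exact ⟨a, hau, by simp⟩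
  · have h1 : p ∣ a.descFactorial (u + 1) := by
      rw [Nat.descFactorial_eq_factorial_mul_choose]; exact Dvd.dvd.mul_left h _
    rw [Nat.descFactorial_eq_prod_range] at h1
    obtain ⟨j, hj, hd⟩ := (hp.prime.dvd_finsetProd_iff _).1 h1
    simp only [Finset.mem_range] at hj
    refine ⟨j, by omega, ?_⟩
    have : ((a - j : ℕ) : ℤ) = (a : ℤ) - j := by push_cast [show j ≤ a by omega]; ring
    rw [← this]; exact_mod_cast hd

theorem bq_core {β : Type} (P : ℕ → (β → ℕ) → ℤ)
    (hP : ∀ (m : ℤ) (k k' : ℕ) (t t' : β → ℕ), m ∣ (k : ℤ) - k' → (∀ b, m ∣ (t b : ℤ) - t' b) →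
      m ∣ P k t - P k' t')
    {u : ℕ} (hy : y ≤ Q) (hu : u + 1 ≤ Q) (h3 : 3 ≤ Q)
    (hbd : ∀ k < y, ∀ t : β → ℕ, (∀ b, t b ≤ u) → |P k t| ≤ Q)
    (hN : N + 1 = Q.factorial * Q.factorial) :
    (∀ k < y, ∃ t : β → ℕ, (∀ b, t b ≤ u) ∧ P k t = 0) ↔
      ∃ a : β → ℕ, (∀ b, N.choose y ∣ (a b).choose (u + 1)) ∧ (N.choose y : ℤ) ∣ P N a := by
  have hNk : ∀ k < y, (md N k : ℤ) ∣ (N : ℤ) - k := fun k hk => by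
    have e1 := (md_spec hy hN hk).1
    exact ⟨k + 1, by rw [← e1]; push_cast; rw [e1]; ring⟩
  constructor
  · intro h
    choose! t ht1 ht2 using h
    have hcop : Set.Pairwise (Finset.range y : Set ℕ) (Function.onFun Nat.Coprime (md N)) := by
      intro k hk l hl hkl
      simp only [Finset.coe_range, Set.mem_Iio] at hk hl
      exact md_coprime hy hN hk hl hkl
    have hcopZ : ∀ (z : ℤ), (∀ k < y, (md N k : ℤ) ∣ z) → (N.choose y : ℤ) ∣ z := by
      intro z hz
      rw [← prod_md hy hN, Nat.cast_prod]
      refine Finset.prod_dvd_of_coprime ?_ ?_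
      · intro k hk l hl hkl
        exact Nat.isCoprime_iff_coprime.2 (hcop hk hl hkl)
      · intro k hk
        exact hz k (by simpa using hk)
    have hne : ∀ k ∈ Finset.range y, md N k ≠ 0 := by
      intro k hk h0
      obtain ⟨-, w, hw0, hw⟩ := md_spec hy hN (show k < y by simpa using hk)
      rw [h0] at hw
      have h2 := Nat.self_le_factorial Q
      have : 1 * Q.factorial ≤ w * Q.factorial := Nat.mul_le_mul_right _ hw0
      omega
    let a : β → ℕ := fun b =>
      (Nat.chineseRemainderOfFinset (fun k => t k b) (md N) (Finset.range y) hne hcop : ℕ)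
    have ha : ∀ b, ∀ k < y, a b ≡ t k b [MOD md N k] := fun b k hk =>
      (Nat.chineseRemainderOfFinset (fun k => t k b) (md N) (Finset.range y) hne hcop).2 k
        (by simpa using hk)
    have ha' : ∀ b, ∀ k < y, (md N k : ℤ) ∣ (a b : ℤ) - t k b := fun b k hk =>
      (Nat.modEq_iff_dvd.1 (ha b k hk).symm)
    refine ⟨a, fun b => ?_, ?_⟩
    · have := hcopZ ((a b).choose (u + 1) : ℤ) ?_
      · exact_mod_cast this
      intro k hk
      have hc : Nat.Coprime (md N k) (u + 1).factorial := by
        apply Nat.Coprime.symm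
        apply Nat.coprime_of_dvd
        intro p hp h1 h2
        have := prime_gt hy hN hk hp h2
        have := (hp.dvd_factorial).1 h1
        omega
      have hd : md N k ∣ (u + 1).factorial * (a b).choose (u + 1) := by
        rw [← Nat.descFactorial_eq_factorial_mul_choose]
        by_cases hau : a b < u + 1
        · rw [Nat.descFactorial_eq_zero_iff_lt.2 hau]; simp
        · rw [Nat.descFactorial_eq_prod_range]
          have hle := ht1 k hk b
          refine dvd_trans ?_ (Finset.dvd_prod_of_mem _ (Finset.mem_range.2
            (show t k b < u + 1 by omega)))
          have h5 := ha' b k hk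
          have : ((a b - t k b : ℕ) : ℤ) = (a b : ℤ) - t k b := by
            push_cast [show t k b ≤ a b by omega]; ring
          rw [← this] at h5
          exact_mod_cast h5
      exact_mod_cast hc.dvd_of_dvd_mul_left hd
    · apply hcopZ
      intro k hk
      have := hP (md N k) N k a (t k) (hNk k hk) (fun b => ha' b k hk)
      rw [ht2 k hk, sub_zero] at this
      exact this
  · rintro ⟨a, ha1, ha2⟩ k hk
    have hne : md N k ≠ 1 := by
      intro h0
      obtain ⟨-, w, hw0, hw⟩ := md_spec hy hN hk
      rw [h0] at hw
      have h2 := Nat.self_le_factorial Q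
      have : 1 * Q.factorial ≤ w * Q.factorial := Nat.mul_le_mul_right _ hw0
      omega
    obtain ⟨p, hp, hpd⟩ := Nat.exists_prime_and_dvd hne
    have hQ := prime_gt hy hN hk hp hpd
    have hpc : p ∣ N.choose y := by
      rw [← prod_md hy hN]
      exact hpd.trans (Finset.dvd_prod_of_mem _ (Finset.mem_range.2 hk))
    choose t ht1 ht2 using fun b => prime_dvd_choose hp (hpc.trans (ha1 b))
    refine ⟨t, ht1, ?_⟩
    have h1 := hP p N k a t ((Int.natCast_dvd_natCast.2 hpd).trans (hNk k hk)) ht2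
    have h2 : (p : ℤ) ∣ P N a := (Int.natCast_dvd_natCast.2 hpc).trans ha2
    have h4 : (p : ℤ) ∣ P k t := by
      have := dvd_sub h2 h1
      simpa using this
    apply Int.eq_zero_of_abs_lt_dvd h4
    have := hbd k hk t ht1
    omega

end core

end DPRM

namespace DPRM

open Dioph Sum

theorem univ_dioph {α : Type} : Dioph (Set.univ : Set (α → ℕ)) :=
  Dioph.of_no_dummies _ (Poly.const 0) fun v => by simp

theorem forall_finset_dioph {α ι : Type} (s : Finset ι) (S : ι → Set (α → ℕ))
    (h : ∀ i, Dioph (S i)) : Dioph {v | ∀ i ∈ s, v ∈ S i} := by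
  classical
  induction s using Finset.induction_on with
  | empty => exact univ_dioph.ext fun v => by simp
  | insert i s _ ih => exact ((h i).inter ih).ext fun v => by simp

theorem forall_dioph {α ι : Type} [Fintype ι] (S : ι → Set (α → ℕ))
    (h : ∀ i, Dioph (S i)) : Dioph {v | ∀ i, v ∈ S i} :=
  (forall_finset_dioph Finset.univ S h).ext fun v => by simp

theorem comp_dioph {α β : Type} [Fintype β] {S : Set (β → ℕ)} (hS : Dioph S)
    (g : β → (α → ℕ) → ℕ) (hg : ∀ b, DiophFn (g b)) : Dioph {v | (fun b => g b v) ∈ S} := by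
  have h1 : Dioph {w : α ⊕ β → ℕ | ∀ b, w ∈ {w : α ⊕ β → ℕ | g b (w ∘ inl) = w (inr b)}} :=
    forall_dioph _ fun b => eq_dioph (reindex_diophFn inl (hg b)) (proj_dioph (inr b))
  have h2 := reindex_dioph (α ⊕ β) inr hS
  refine (ex_dioph (h1.inter h2)).ext fun v => ?_
  constructor
  · rintro ⟨x, hx1, hx2⟩
    have : (fun b => g b v) = x := funext fun b => hx1 b
    simp only [Set.mem_ofPred_eq, this]
    exact hx2
  · intro hv
    exact ⟨fun b => g b v, fun b => rfl, hv⟩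

theorem comp_diophFn {α β : Type} [Fintype β] {f : (β → ℕ) → ℕ} (hf : DiophFn f)
    (g : β → (α → ℕ) → ℕ) (hg : ∀ b, DiophFn (g b)) : DiophFn fun v => f fun b => g b v := by
  refine (comp_dioph hf (α := Option α)
    (fun o => o.elim (fun w => w none) (fun b w => g b (w ∘ some))) ?_)
  rintro (_ | b)
  · exact proj_dioph none
  · exact reindex_diophFn some (hg b)

theorem choose_dioph {α : Type} {f g : (α → ℕ) → ℕ} (hf : DiophFn f) (hg : DiophFn g) :
    DiophFn fun v => (f v).choose (g v) := by
  have c1 : DiophFn fun _ : α → ℕ => 1 := const_dioph 1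
  have c2 : DiophFn fun _ : α → ℕ => 2 := const_dioph 2
  have hu := add_dioph (pow_dioph c2 hf) c1
  have := mod_dioph (div_dioph (pow_dioph (add_dioph c1 hu) hf) (pow_dioph hu hg)) hu
  simp only [choose_eq]
  exact this

theorem factorial_dioph {α : Type} {f : (α → ℕ) → ℕ} (hf : DiophFn f) :
    DiophFn fun v => (f v).factorial := by
  have c1 : DiophFn fun _ : α → ℕ => 1 := const_dioph 1
  have hr := add_dioph (mul_dioph (add_dioph (pow_dioph hf hf) c1) (mul_dioph hf hf)) c1
  have := div_dioph (pow_dioph hr hf) (choose_dioph hr hf)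
  simp only [factorial_eq]
  exact this

theorem sum_dioph {α ι : Type} (s : Finset ι) (f : ι → (α → ℕ) → ℕ) (h : ∀ i, DiophFn (f i)) :
    DiophFn fun v => ∑ i ∈ s, f i v := by
  classical
  induction s using Finset.induction_on with
  | empty => simpa using! (const_dioph 0 : DiophFn fun _ : α → ℕ => 0)
  | insert i s hi ih => simpa only [Finset.sum_insert hi] using add_dioph (h i) ih

/-- finitely many dummies suffice -/
theorem poly_finset {α β : Type} (p : Poly (α ⊕ β)) :
    ∃ B : Finset β, ∀ (v : α → ℕ) (t t' : β → ℕ), (∀ b ∈ B, t b = t' b) →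
      p (Sum.elim v t) = p (Sum.elim v t') := by
  classical
  induction p using Poly.induction with
  | H1 i =>
    rcases i with a | b
    · exact ⟨∅, fun v t t' _ => by simp⟩
    · exact ⟨{b}, fun v t t' h => by simpa using h b⟩
  | H2 n => exact ⟨∅, fun v t t' _ => by simp⟩
  | H3 f g hf hg =>
    obtain ⟨A, hA⟩ := hf
    obtain ⟨B, hB⟩ := hg
    refine ⟨A ∪ B, fun v t t' h => ?_⟩
    rw [Poly.sub_apply, Poly.sub_apply, hA v t t' fun b hb => h b (by simp [hb]),
      hB v t t' fun b hb => h b (by simp [hb])]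
  | H4 f g hf hg =>
    obtain ⟨A, hA⟩ := hf
    obtain ⟨B, hB⟩ := hg
    refine ⟨A ∪ B, fun v t t' h => ?_⟩
    rw [Poly.mul_apply, Poly.mul_apply, hA v t t' fun b hb => h b (by simp [hb]),
      hB v t t' fun b hb => h b (by simp [hb])]

theorem finite_dummies {α : Type} {S : Set (α → ℕ)} (hS : Dioph S) :
    ∃ (m : ℕ) (p : Poly (α ⊕ Fin m)), ∀ v, v ∈ S ↔ ∃ t, p (Sum.elim v t) = 0 := by
  classical
  obtain ⟨β, p, hp⟩ := hS
  obtain ⟨B, hB⟩ := poly_finset p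
  let e : Option B ≃ Fin (Fintype.card (Option B)) := Fintype.equivFin _
  let φ : β → Fin (Fintype.card (Option B)) := fun b =>
    if h : b ∈ B then e (some ⟨b, h⟩) else e none
  refine ⟨_, p.map (Sum.elim inl (inr ∘ φ)), fun v => ?_⟩
  have hc : ∀ t : Fin (Fintype.card (Option B)) → ℕ,
      (Sum.elim v t) ∘ (Sum.elim inl (inr ∘ φ)) = Sum.elim v (t ∘ φ) := fun t => by
    funext x; rcases x with a | b <;> rfl
  rw [hp]
  constructor
  · rintro ⟨t, ht⟩
    refine ⟨fun i => (e.symm i).elim 0 (fun b => t b), ?_⟩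
    rw [Poly.map_apply, hc, ← ht]
    apply hB
    intro b hb
    simp [φ, hb]
  · rintro ⟨t, ht⟩
    rw [Poly.map_apply, hc] at ht
    exact ⟨_, ht⟩

theorem poly_congr {γ : Type} (p : Poly γ) (m : ℤ) (x x' : γ → ℕ)
    (h : ∀ i, m ∣ (x i : ℤ) - x' i) : m ∣ p x - p x' := by
  induction p using Poly.induction with
  | H1 i => simpa using h i
  | H2 n => simp
  | H3 f g hf hg =>
    have := dvd_sub hf hg
    rw [Poly.sub_apply, Poly.sub_apply,
      show f x - g x - (f x' - g x') = f x - f x' - (g x - g x') by ring]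
    exact this
  | H4 f g hf hg =>
    rw [Poly.mul_apply, Poly.mul_apply]
    have := dvd_add (hf.mul_right (g x)) (hg.mul_left (f x'))
    rw [show f x * g x - f x' * g x' = (f x - f x') * g x + f x' * (g x - g x') by ring]
    exact this

theorem poly_bound {γ : Type} (p : Poly γ) :
    ∃ d : ℕ, ∀ (x : γ → ℕ) (s : ℕ), (∀ i, x i ≤ s) → |p x| ≤ (((s + 2) ^ d : ℕ) : ℤ) := by
  have mono : ∀ s a b : ℕ, a ≤ b → (((s + 2) ^ a : ℕ) : ℤ) ≤ (((s + 2) ^ b : ℕ) : ℤ) :=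
    fun s a b h => by exact_mod_cast Nat.pow_le_pow_right (by omega) h
  induction p using Poly.induction with
  | H1 i =>
    refine ⟨1, fun x s h => ?_⟩
    have := h i
    simp only [Poly.proj_apply, Nat.abs_cast, pow_one]
    exact_mod_cast by omega
  | H2 n =>
    refine ⟨n.natAbs, fun x s h => ?_⟩
    rw [Poly.const_apply, Int.abs_eq_natAbs]
    have h1 : n.natAbs < 2 ^ n.natAbs := Nat.lt_two_pow_self
    have h2 : 2 ^ n.natAbs ≤ (s + 2) ^ n.natAbs := Nat.pow_le_pow_left (by omega) _
    exact_mod_cast by omega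
  | H3 f g hf hg =>
    obtain ⟨a, ha⟩ := hf
    obtain ⟨b, hb⟩ := hg
    refine ⟨a + b + 1, fun x s h => ?_⟩
    rw [Poly.sub_apply]
    have h1 := ha x s h
    have h2 := hb x s h
    have h3 := mono s a (a + b) (by omega)
    have h4 := mono s b (a + b) (by omega)
    have h5 := abs_sub (f x) (g x)
    have h6 : 2 * (s + 2) ^ (a + b) ≤ (s + 2) ^ (a + b + 1) := by
      rw [pow_succ, mul_comm]; exact Nat.mul_le_mul_left _ (by omega)
    have h7 : (2 : ℤ) * (((s + 2) ^ (a + b) : ℕ) : ℤ) ≤ (((s + 2) ^ (a + b + 1) : ℕ) : ℤ) := by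
      exact_mod_cast h6
    linarith
  | H4 f g hf hg =>
    obtain ⟨a, ha⟩ := hf
    obtain ⟨b, hb⟩ := hg
    refine ⟨a + b, fun x s h => ?_⟩
    rw [Poly.mul_apply, abs_mul, pow_add, Nat.cast_mul]
    exact mul_le_mul (ha x s h) (hb x s h) (abs_nonneg _) (by positivity)

/-- Diophantine sets are closed under bounded universal quantification. -/
theorem ball_dioph {α : Type} [Fintype α] {S : Set (Option α → ℕ)} (hS : Dioph S)
    {f : (α → ℕ) → ℕ} (hf : DiophFn f) :
    Dioph {v : α → ℕ | ∀ k < f v, Option.elim' k v ∈ S} := by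
  obtain ⟨m, p, hp⟩ := finite_dummies hS
  obtain ⟨d, hd⟩ := poly_bound p
  let γ := α ⊕ Option (Option (Fin m))
  let s : (γ → ℕ) → ℕ := fun w => ((∑ a, w (inl a)) + f (w ∘ inl)) + w (inr none)
  let Q : (γ → ℕ) → ℕ := fun w => (s w + 2) ^ d + (s w + 3)
  have c (n : ℕ) : DiophFn fun _ : γ → ℕ => n := const_dioph n
  have df : DiophFn fun w : γ → ℕ => f (w ∘ inl) := reindex_diophFn inl hf
  have dN : DiophFn fun w : γ → ℕ => w (inr (some none)) := proj_dioph _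
  have du : DiophFn fun w : γ → ℕ => w (inr none) := proj_dioph _
  have ds : DiophFn s :=
    add_dioph (add_dioph (sum_dioph _ _ fun a => proj_dioph (inl a)) df) du
  have dQ : DiophFn Q := add_dioph (pow_dioph (add_dioph ds (c 2)) (c d)) (add_dioph ds (c 3))
  have dC : DiophFn fun w : γ → ℕ => (w (inr (some none))).choose (f (w ∘ inl)) :=
    choose_dioph dN df
  have T1 := eq_dioph (add_dioph dN (c 1)) (mul_dioph (factorial_dioph dQ) (factorial_dioph dQ))
  have T2 := forall_dioph (fun b : Fin m => {w : γ → ℕ |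
      (w (inr (some none))).choose (f (w ∘ inl)) ∣
        (w (inr (some (some b)))).choose (w (inr none) + 1)})
    fun b => dvd_dioph dC (choose_dioph (proj_dioph _) (add_dioph du (c 1)))
  let φ : Option α ⊕ Fin m → γ :=
    Sum.elim (Option.elim' (inr (some none)) inl) (fun b => inr (some (some b)))
  have T3 := dvd_dioph dC (reindex_diophFn φ (abs_poly_dioph p))
  refine (ex_dioph (T1.inter (T2.inter T3))).ext fun v => ?_
  let P : ℕ → (Fin m → ℕ) → ℤ := fun k t => p (Sum.elim (Option.elim' k v) t)
  have hP : ∀ (m' : ℤ) (k k' : ℕ) (t t' : Fin m → ℕ), m' ∣ (k : ℤ) - k' →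
      (∀ b, m' ∣ (t b : ℤ) - t' b) → m' ∣ P k t - P k' t' := by
    intro m' k k' t t' h1 h2
    apply poly_congr
    rintro ((_ | a) | b)
    · exact h1
    · simp
    · exact h2 b
  have core : ∀ (u N : ℕ) (a : Fin m → ℕ),
      let x : Option (Option (Fin m)) → ℕ := Option.elim' u (Option.elim' N a)
      N + 1 = (Q (Sum.elim v x)).factorial * (Q (Sum.elim v x)).factorial →
      ((∀ k < f v, ∃ t : Fin m → ℕ, (∀ b, t b ≤ u) ∧ P k t = 0) ↔
      ∃ a : Fin m → ℕ, (∀ b, N.choose (f v) ∣ (a b).choose (u + 1)) ∧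
        (N.choose (f v) : ℤ) ∣ P N a) := by
    intro u N a x hN
    have hs : s (Sum.elim v x) = (∑ a, v a) + f v + u := rfl
    have hQ : Q (Sum.elim v x) = ((∑ a, v a) + f v + u + 2) ^ d + ((∑ a, v a) + f v + u + 3) := rfl
    refine bq_core P hP (by rw [hQ]; omega) (by rw [hQ]; omega) (by rw [hQ]; omega) ?_ hN
    intro k hk t ht
    have := hd (Sum.elim (Option.elim' k v) t) ((∑ a, v a) + f v + u) ?_
    · refine this.trans ?_
      rw [hQ]
      push_cast
      have : (0 : ℤ) ≤ (∑ a, (v a : ℤ)) := by positivity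
      linarith
    · rintro ((_ | a) | b)
      · simp only [elim_inl, Option.elim'_none]; omega
      · have := Finset.single_le_sum (f := v) (fun i _ => Nat.zero_le _) (Finset.mem_univ a)
        simp only [elim_inl, Option.elim'_some]; omega
      · have := ht b
        simp only [elim_inr]; omega
  have hφ : ∀ (u N : ℕ) (a : Fin m → ℕ),
      (Sum.elim v (Option.elim' u (Option.elim' N a))) ∘ φ = Sum.elim (Option.elim' N v) a := by
    intro u N a
    funext i
    rcases i with (_ | i) | b <;> rfl
  constructor
  · rintro ⟨x, h1, h2, h3⟩ k hk
    obtain ⟨u, N, a, rfl⟩ : ∃ u N a, x = Option.elim' u (Option.elim' N a) :=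
      ⟨x none, x (some none), fun b => x (some (some b)), by
        funext i; rcases i with _ | _ | b <;> rfl⟩
    obtain ⟨t, -, ht⟩ := (core u N a h1).2 ⟨a, h2, by
      have h3 : N.choose (f v) ∣ (p (Sum.elim v (Option.elim' u (Option.elim' N a)) ∘ φ)).natAbs :=
        h3
      rw [hφ] at h3
      exact Int.natCast_dvd.2 h3⟩ k hk
    exact (hp _).2 ⟨t, ht⟩
  · intro h
    have h' : ∀ k < f v, ∃ t : Fin m → ℕ, P k t = 0 := fun k hk => (hp _).1 (h k hk)
    choose! t ht using h'
    let u := ∑ k ∈ Finset.range (f v), ∑ b, t k b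
    have hu : ∀ k < f v, ∀ b, t k b ≤ u := fun k hk b =>
      (Finset.single_le_sum (f := t k) (fun i _ => Nat.zero_le _) (Finset.mem_univ b)).trans
        (Finset.single_le_sum (f := fun k => ∑ b, t k b) (fun i _ => Nat.zero_le _)
          (Finset.mem_range.2 hk))
    let Q0 := ((∑ a, v a) + f v + u + 2) ^ d + ((∑ a, v a) + f v + u + 3)
    let N := Q0.factorial * Q0.factorial - 1
    have hN : N + 1 = Q0.factorial * Q0.factorial :=
      Nat.sub_add_cancel (Nat.mul_pos (Nat.factorial_pos _) (Nat.factorial_pos _))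
    obtain ⟨a, ha1, ha2⟩ := (core u N (fun _ => 0) hN).1 fun k hk => ⟨t k, hu k hk, ht k hk⟩
    refine ⟨Option.elim' u (Option.elim' N a), hN, ha1, ?_⟩
    show N.choose (f v) ∣ (p (Sum.elim v (Option.elim' u (Option.elim' N a)) ∘ φ)).natAbs
    rw [hφ]
    exact Int.natCast_dvd.1 ha2

end DPRM

namespace DPRM

open Dioph Sum

theorem beta_exists (F : ℕ → ℕ) (y : ℕ) : ∃ a b : ℕ, ∀ i ≤ y, a % ((i + 1) * b + 1) = F i := by
  let l := (List.range (y + 1)).map F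
  refine ⟨(Nat.unbeta l).unpair.1, (Nat.unbeta l).unpair.2, fun i hi => ?_⟩
  have h := Nat.beta_unbeta_coe l ⟨i, by simp [l]; omega⟩
  simpa [Nat.beta, l] using h

theorem prec_dioph {α : Type} [Fintype α] {f h : (α → ℕ) → ℕ} {g : (Option (Option α) → ℕ) → ℕ}
    (hf : DiophFn f) (hh : DiophFn h) (hg : DiophFn g) :
    DiophFn fun v : α → ℕ => Nat.rec (motive := fun _ => ℕ) (f v)
      (fun y IH => g (Option.elim' y (Option.elim' IH v))) (h v) := by
  let γ := Option α ⊕ Bool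
  let ι : α → γ := fun a => inl (some a)
  have c (δ : Type) (n : ℕ) : DiophFn fun _ : δ → ℕ => n := const_dioph n
  have dbeta {δ : Type} {a b i : (δ → ℕ) → ℕ} (ha : DiophFn a) (hb : DiophFn b)
      (hi : DiophFn i) : DiophFn fun w => a w % ((i w + 1) * b w + 1) :=
    mod_dioph ha (add_dioph (mul_dioph (add_dioph hi (c _ 1)) hb) (c _ 1))
  have da : DiophFn fun w : γ → ℕ => w (inr true) := proj_dioph _
  have db : DiophFn fun w : γ → ℕ => w (inr false) := proj_dioph _
  have df : DiophFn fun w : γ → ℕ => f (w ∘ ι) := reindex_diophFn ι hf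
  have dh : DiophFn fun w : γ → ℕ => h (w ∘ ι) := reindex_diophFn ι hh
  have T1 := eq_dioph (dbeta da db (c γ 0)) df
  have T2 := eq_dioph (dbeta da db dh) (proj_dioph (inl none : γ))
  have da' : DiophFn fun w : Option γ → ℕ => w (some (inr true)) := proj_dioph _
  have db' : DiophFn fun w : Option γ → ℕ => w (some (inr false)) := proj_dioph _
  have dk' : DiophFn fun w : Option γ → ℕ => w none := proj_dioph _
  have dg' := comp_diophFn (α := Option γ) hg
    (fun o => Option.elim' (fun w => w none)
      (Option.elim' (fun w => w (some (inr true)) % ((w none + 1) * w (some (inr false)) + 1))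
        (fun a w => w (some (ι a)))) o) (by
      rintro (_ | _ | a)
      · exact dk'
      · exact dbeta da' db' dk'
      · exact proj_dioph _)
  have T3 := ball_dioph (eq_dioph (dbeta da' db' (add_dioph dk' (c _ 1))) dg') dh
  refine (ex_dioph (T1.inter (T2.inter T3))).ext fun v => ?_
  have harg : ∀ (k : ℕ) (x : Bool → ℕ),
      (fun o => (Option.elim' (fun w : Option γ → ℕ => w none)
      (Option.elim' (fun w => w (some (inr true)) % ((w none + 1) * w (some (inr false)) + 1))
        (fun a w => w (some (ι a)))) o : (Option γ → ℕ) → ℕ) (Option.elim' k (Sum.elim v x))) =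
      Option.elim' k (Option.elim' (x true % ((k + 1) * x false + 1)) (v ∘ some)) := by
    intro k x
    funext o
    rcases o with _ | _ | a <;> rfl
  constructor
  · rintro ⟨x, h1, h2, h3⟩
    have h1 : x true % ((0 + 1) * x false + 1) = f (v ∘ some) := h1
    have h2 : x true % ((h (v ∘ some) + 1) * x false + 1) = v none := h2
    have h3 : ∀ k < h (v ∘ some), x true % ((k + 1 + 1) * x false + 1) =
        g (Option.elim' k (Option.elim' (x true % ((k + 1) * x false + 1)) (v ∘ some))) := by
      intro k hk
      rw [← harg]
      exact h3 k hk
    have key : ∀ k ≤ h (v ∘ some), Nat.rec (motive := fun _ => ℕ) (f (v ∘ some))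
      (fun y IH => g (Option.elim' y (Option.elim' IH (v ∘ some)))) k =
        x true % ((k + 1) * x false + 1) := by
      intro k
      induction k with
      | zero => intro _; exact h1.symm
      | succ k ih =>
        intro hk
        rw [h3 k (by omega), ← ih (by omega)]
    exact (key _ le_rfl).trans h2
  · intro hv
    have hv : Nat.rec (motive := fun _ => ℕ) (f (v ∘ some))
      (fun y IH => g (Option.elim' y (Option.elim' IH (v ∘ some)))) (h (v ∘ some)) = v none := hv
    obtain ⟨a, b, hab⟩ := beta_exists (fun k => Nat.rec (motive := fun _ => ℕ) (f (v ∘ some))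
      (fun y IH => g (Option.elim' y (Option.elim' IH (v ∘ some)))) k) (h (v ∘ some))
    let x : Bool → ℕ := fun i => if i then a else b
    refine ⟨x, hab 0 (Nat.zero_le _), (hab _ le_rfl).trans hv, ?_⟩
    intro k hk
    have hk : k < h (v ∘ some) := hk
    have h4 : a % ((k + 1 + 1) * b + 1) =
        g (Option.elim' k (Option.elim' (a % ((k + 1) * b + 1)) (v ∘ some))) := by
      rw [hab (k + 1) hk, hab k hk.le]
    have h5 := harg k x
    have h6 : a % ((k + 1 + 1) * b + 1) = g (fun o => (Option.elim' (fun w : Option γ → ℕ => w none)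
      (Option.elim' (fun w => w (some (inr true)) % ((w none + 1) * w (some (inr false)) + 1))
        (fun a w => w (some (ι a)))) o : (Option γ → ℕ) → ℕ) (Option.elim' k (Sum.elim v x))) := by
      rw [h5]; exact h4
    exact h6

open List.Vector in
theorem primrec_dioph {n : ℕ} {f : List.Vector ℕ n → ℕ} (hf : Nat.Primrec' f) :
    DiophFn fun v : Fin n → ℕ => f (List.Vector.ofFn v) := by
  induction hf with
  | zero => exact const_dioph 0
  | succ => exact add_dioph (proj_dioph (0 : Fin 1)) (const_dioph 1)
  | get i => simpa using proj_dioph i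
  | comp g _ _ ihf ihg => exact comp_diophFn ihf _ ihg
  | @prec n f g _ _ ihf ihg =>
    have hf' : DiophFn fun v : Fin (n + 1) → ℕ => f (ofFn (v ∘ Fin.succ)) :=
      reindex_diophFn Fin.succ ihf
    let ψ : Fin (n + 2) → Option (Option (Fin (n + 1))) :=
      Fin.cons none (Fin.cons (some none) fun i => some (some i.succ))
    have hg' := reindex_diophFn ψ ihg
    have := prec_dioph hf' (proj_dioph (0 : Fin (n + 1))) hg'
    have e : ∀ (v : Fin (n + 1) → ℕ) (y IH : ℕ), (Option.elim' y (Option.elim' IH v)) ∘ ψ =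
        Fin.cons y (Fin.cons IH (v ∘ Fin.succ)) := by
      intro v y IH
      funext i
      refine Fin.cases rfl (fun i => ?_) i
      refine Fin.cases rfl (fun i => ?_) i
      rfl
    simp only [e] at this
    exact this

theorem mem_mOfFn {n : ℕ} (g : Fin n → Part ℕ) (x : List.Vector ℕ n) :
    x ∈ List.Vector.mOfFn g ↔ ∀ i, x.get i ∈ g i := by
  induction n with
  | zero =>
    have : x = List.Vector.nil := Subsingleton.elim _ _
    subst this
    simp only [List.Vector.mOfFn, IsEmpty.forall_iff, iff_true]
    exact Part.mem_some _
  | succ n ih =>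
    simp only [List.Vector.mOfFn, Part.bind_eq_bind, Part.mem_bind_iff, Fin.forall_fin_succ, ih]
    constructor
    · rintro ⟨a, ha, w, hw, h⟩
      have := Part.mem_some_iff.1 h
      subst this
      simpa using ⟨ha, hw⟩
    · rintro ⟨h1, h2⟩
      refine ⟨_, h1, x.tail, fun i => by simpa using h2 i, ?_⟩
      refine Part.mem_some_iff.2 ?_
      simp

theorem partrec_dioph {n : ℕ} {f : List.Vector ℕ n →. ℕ} (hf : Nat.Partrec' f) :
    Dioph {w : Option (Fin n) → ℕ | w none ∈ f (List.Vector.ofFn (w ∘ some))} := by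
  induction hf with
  | prim hf =>
    refine Dioph.ext (primrec_dioph hf) fun w => ?_
    exact eq_comm.trans Part.mem_some_iff.symm
  | @comp m n f g _ _ ihf ihg =>
    let γ := Option (Fin m) ⊕ Fin n
    have T1 := forall_dioph (fun i : Fin n => {w : γ → ℕ |
        w ∘ Option.elim' (inr i) (fun j => inl (some j)) ∈
          {w : Option (Fin m) → ℕ | w none ∈ g i (List.Vector.ofFn (w ∘ some))}})
      fun i => reindex_dioph _ _ (ihg i)
    have T2 := reindex_dioph γ (Option.elim' (inl none) inr) ihf
    refine (ex_dioph (T1.inter T2)).ext fun v => ?_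
    have e : v none ∈ Part.bind (List.Vector.mOfFn fun i => g i (List.Vector.ofFn (v ∘ some))) f ↔
        ∃ x : List.Vector ℕ n, (∀ i, x.get i ∈ g i (List.Vector.ofFn (v ∘ some))) ∧
          v none ∈ f x := by
      refine Part.mem_bind_iff.trans (exists_congr fun x => ?_)
      exact and_congr_left fun _ => mem_mOfFn (fun i => g i (List.Vector.ofFn (v ∘ some))) x
    refine Iff.trans ?_ e.symm
    constructor
    · rintro ⟨x, h1, h2⟩
      exact ⟨List.Vector.ofFn x, fun i => by rw [List.Vector.get_ofFn]; exact h1 i, h2⟩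
    · rintro ⟨x, h1, h2⟩
      refine ⟨x.get, fun i => h1 i, ?_⟩
      rw [← List.Vector.ofFn_get x] at h2
      exact h2
  | @rfind n f _ ih =>
    have ih' : DiophFn fun v : Fin (n + 1) → ℕ => f (List.Vector.ofFn v) :=
      ih.ext fun w => Part.mem_some_iff.trans eq_comm
    let φ : Fin (n + 1) → Option (Fin n) := Fin.cons none some
    let ψ : Fin (n + 1) → Option (Option (Fin n)) := Fin.cons none (fun i => some (some i))
    have T1 := eq_dioph (reindex_diophFn φ ih') (const_dioph 0)
    have T2 := ball_dioph (ne_dioph (reindex_diophFn ψ ih') (const_dioph 0))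
      (proj_dioph (none : Option (Fin n)))
    refine (T1.inter T2).ext fun v => ?_
    have e1 : v ∘ φ = Fin.cons (v none) (v ∘ some) := by
      funext i
      refine Fin.cases rfl (fun i => rfl) i
    have e2 : ∀ k, Option.elim' k v ∘ ψ = Fin.cons k (v ∘ some) := by
      intro k
      funext i
      refine Fin.cases rfl (fun i => rfl) i
    have e3 : ∀ k, List.Vector.ofFn (Fin.cons k (v ∘ some)) = k ::ᵥ List.Vector.ofFn (v ∘ some) :=
      fun k => rfl
    have e4 : v none ∈ Nat.rfind (fun k => Part.some
        (decide (f (k ::ᵥ List.Vector.ofFn (v ∘ some)) = 0))) ↔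
        f (v none ::ᵥ List.Vector.ofFn (v ∘ some)) = 0 ∧
          ∀ k < v none, f (k ::ᵥ List.Vector.ofFn (v ∘ some)) ≠ 0 := by
      refine Nat.mem_rfind.trans (and_congr ?_ (forall_congr' fun k => forall_congr' fun _ => ?_))
      · refine Part.mem_some_iff.trans ?_
        simp
      · refine Part.mem_some_iff.trans ?_
        simp
    refine Iff.trans ?_ e4.symm
    simp only [Set.mem_inter_iff, Set.mem_ofPred_eq, e1, e2, e3, Function.const]

theorem computable_dioph {g : ℕ → ℕ} (hg : Computable g) :
    Dioph {v : Fin 2 → ℕ | g (v 0) + 1 = v 1} := by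
  have h1 := partrec_dioph (Nat.Partrec'.part_iff₁.2 hg)
  have h2 : DiophFn fun v : Fin 1 → ℕ => g (v 0) :=
    h1.ext fun w => Part.mem_some_iff.trans eq_comm
  have h3 := reindex_diophFn (fun _ => (0 : Fin 2)) h2
  exact eq_dioph (add_dioph h3 (const_dioph 1)) (proj_dioph (1 : Fin 2))

theorem poly_mv {γ : Type} (p : Poly γ) :
    ∃ q : MvPolynomial γ ℤ, ∀ x : γ → ℕ, MvPolynomial.eval (fun i => (x i : ℤ)) q = p x := by
  induction p using Poly.induction with
  | H1 i => exact ⟨MvPolynomial.X i, fun x => by simp⟩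
  | H2 n => exact ⟨MvPolynomial.C n, fun x => by simp⟩
  | H3 f g hf hg =>
    obtain ⟨a, ha⟩ := hf
    obtain ⟨b, hb⟩ := hg
    exact ⟨a - b, fun x => by simp [ha, hb]⟩
  | H4 f g hf hg =>
    obtain ⟨a, ha⟩ := hf
    obtain ⟨b, hb⟩ := hg
    exact ⟨a * b, fun x => by simp [ha, hb]⟩

theorem exists_rep {g : ℕ → ℕ} (hg : Computable g) :
    ∃ (i : ℕ) (D : MvPolynomial (Fin (i + 1)) ℤ) (t0 : Fin i),
      (∀ j : ℕ, ∃ x : Fin i → ℕ,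
        MvPolynomial.eval (Fin.cons (j : ℤ) (fun t => (x t : ℤ))) D = 0) ∧
      ∀ (j : ℕ) (x : Fin i → ℕ),
        MvPolynomial.eval (Fin.cons (j : ℤ) (fun t => (x t : ℤ))) D = 0 → x t0 = g j + 1 := by
  obtain ⟨m, p, hp⟩ := finite_dummies (computable_dioph hg)
  obtain ⟨q, hq⟩ := poly_mv p
  let φ : Fin 2 ⊕ Fin m → Fin (m + 1 + 1) := Sum.elim ![0, 1] fun j => j.succ.succ
  have key : ∀ (j z : ℕ) (t : Fin m → ℕ),
      MvPolynomial.eval (Fin.cons (j : ℤ) (fun i => ((Fin.cons z t : Fin (m + 1) → ℕ) i : ℤ)))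
        (MvPolynomial.rename φ q) = p (Sum.elim ![j, z] t) := by
    intro j z t
    rw [MvPolynomial.eval_rename, ← hq]
    congr 2
    funext i
    rcases i with i | i
    · fin_cases i <;> rfl
    · rfl
  refine ⟨m + 1, MvPolynomial.rename φ q, 0, fun j => ?_, fun j x hx => ?_⟩
  · obtain ⟨t, ht⟩ := (hp ![j, g j + 1]).1 rfl
    exact ⟨Fin.cons (g j + 1) t, (key _ _ _).trans ht⟩
  · obtain ⟨z, t, rfl⟩ : ∃ z t, x = Fin.cons z t := ⟨x 0, Fin.tail x, (Fin.cons_self_tail x).symm⟩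
    rw [key] at hx
    have : g j + 1 = z := (hp ![j, z]).2 ⟨t, hx⟩
    exact this.symm

end DPRM

namespace DPRM

theorem finite_polys (i n : ℕ) : {D : MvPolynomial (Fin (i + 1)) ℤ | D.totalDegree ≤ n ∧
    ∀ m : Fin (i + 1) →₀ ℕ, |MvPolynomial.coeff m D| ≤ (n : ℤ)}.Finite := by
  classical
  let M : Set (Fin (i + 1) →₀ ℕ) := {m | ∀ a, m a ≤ n}
  have hM : M.Finite := by
    refine Set.Finite.subset (Set.finite_Iic
      (Finsupp.equivFunOnFinite.symm fun _ => n : Fin (i + 1) →₀ ℕ)) fun m hm a => ?_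
    simpa using hm a
  have : Finite M := hM
  let F : MvPolynomial (Fin (i + 1)) ℤ → (M → ℤ) := fun D m => MvPolynomial.coeff m.1 D
  refine Set.Finite.of_finite_image (f := F) ?_ ?_
  · refine Set.Finite.subset (Set.Finite.pi' (t := fun _ : M => Set.Icc (-(n : ℤ)) n)
      fun _ => Set.finite_Icc _ _) ?_
    rintro _ ⟨D, ⟨-, hD⟩, rfl⟩ m
    exact abs_le.1 (hD m.1)
  · intro D hD E hE h
    have hz : ∀ D' : MvPolynomial (Fin (i + 1)) ℤ, D'.totalDegree ≤ n → ∀ m, m ∉ M →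
        MvPolynomial.coeff m D' = 0 := by
      intro D' hD' m hm
      by_contra hne
      apply hm
      intro a
      have h1 := MvPolynomial.le_totalDegree (MvPolynomial.mem_support_iff.2 hne)
      have h2 : m a ≤ m.sum fun _ e => e := by
        by_cases ha : m a = 0
        · omega
        · exact Finset.single_le_sum (f := m) (fun _ _ => Nat.zero_le _)
            (Finsupp.mem_support_iff.2 ha)
      exact h2.trans (h1.trans hD')
    ext m
    by_cases hm : m ∈ M
    · exact congrFun h ⟨m, hm⟩
    · rw [hz D hD.1 m hm, hz E hE.1 m hm]

theorem hOmega1_nonempty (n : ℕ) : {b : ℕ | ∀ i : ℕ, i ≤ n → ∀ D : MvPolynomial (Fin (i + 1)) ℤ,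
    D.totalDegree ≤ n →
    (∀ m : Fin (i + 1) →₀ ℕ, |MvPolynomial.coeff m D| ≤ (n : ℤ)) →
    (∀ j : ℕ, ∃ x : Fin i → ℕ,
      MvPolynomial.eval (Fin.cons (j : ℤ) (fun t => (x t : ℤ))) D = 0) →
    ∃ x : Fin i → ℕ,
      MvPolynomial.eval (Fin.cons (n : ℤ) (fun t => (x t : ℤ))) D = 0 ∧
        ∀ t, x t ≤ b}.Nonempty := by
  classical
  have h1 : ∀ i : ℕ, ∀ D : MvPolynomial (Fin (i + 1)) ℤ, ∃ b : ℕ, (∀ j : ℕ, ∃ x : Fin i → ℕ,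
      MvPolynomial.eval (Fin.cons (j : ℤ) (fun t => (x t : ℤ))) D = 0) →
    ∃ x : Fin i → ℕ,
      MvPolynomial.eval (Fin.cons (n : ℤ) (fun t => (x t : ℤ))) D = 0 ∧ ∀ t, x t ≤ b := by
    intro i D
    by_cases h : ∀ j : ℕ, ∃ x : Fin i → ℕ,
      MvPolynomial.eval (Fin.cons (j : ℤ) (fun t => (x t : ℤ))) D = 0
    · obtain ⟨x, hx⟩ := h n
      exact ⟨∑ t, x t, fun _ => ⟨x, hx, fun t =>
        Finset.single_le_sum (f := x) (fun _ _ => Nat.zero_le _) (Finset.mem_univ t)⟩⟩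
    · exact ⟨0, fun h' => absurd h' h⟩
  choose B hB using h1
  refine ⟨∑ i ∈ Finset.range (n + 1), ∑ D ∈ (finite_polys i n).toFinset, B i D, ?_⟩
  intro i hi D hD1 hD2 hD3
  obtain ⟨x, hx1, hx2⟩ := hB i D hD3
  refine ⟨x, hx1, fun t => (hx2 t).trans ?_⟩
  refine (Finset.single_le_sum (f := B i) (fun _ _ => Nat.zero_le _)
    ((finite_polys i n).mem_toFinset.2 ⟨hD1, hD2⟩)).trans ?_
  exact Finset.single_le_sum (f := fun i => ∑ D ∈ (finite_polys i n).toFinset, B i D)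
    (fun _ _ => Nat.zero_le _) (Finset.mem_range.2 (by omega))

end DPRM

theorem stmt_12 (g : ℕ → ℕ) (hg : Computable g) :
    ∃ N : ℕ, 0 < N ∧ ∀ n : ℕ, N ≤ n → g n < hOmega1 n := by
  obtain ⟨i, D, t0, h1, h2⟩ := DPRM.exists_rep hg
  let c : ℕ := ∑ m ∈ D.support, (MvPolynomial.coeff m D).natAbs
  have hc : ∀ m, |MvPolynomial.coeff m D| ≤ (c : ℤ) := by
    intro m
    rw [Int.abs_eq_natAbs]
    by_cases hm : m ∈ D.support
    · exact_mod_cast Finset.single_le_sum (f := fun m => (MvPolynomial.coeff m D).natAbs)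
        (fun _ _ => Nat.zero_le _) hm
    · rw [MvPolynomial.notMem_support_iff.1 hm]
      simp
  refine ⟨i + D.totalDegree + c + 1, by omega, fun n hn => ?_⟩
  have hmem := Nat.sInf_mem (DPRM.hOmega1_nonempty n)
  obtain ⟨x, hx1, hx2⟩ := hmem i (by omega) D (by omega)
    (fun m => (hc m).trans (by exact_mod_cast (show c ≤ n by omega))) h1
  have h3 := hx2 t0
  rw [h2 n x hx1] at h3
  exact h3
end

section
/- Let D(x_1,...,x_n) be a polynomial with integer coefficients such that the equation D(x_1,...,x_n) = 0 has only finitely many solutions in non-negative integers x_1,...,x_n. Then the equation D²(x_1,...,x_n) + (x_1 + ... + x_n − y − z)² = 0 has only finitely many solutions in non-negative integers x_1,...,x_n, y, z, and the number of such solutions is greater than max(a_1,...,a_n) for every solution (a_1,...,a_n) ∈ ℕ^n of D(x_1,...,x_n) = 0. -/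
/-- The set of non-negative integer solutions `(x, y, z)` of the equation
`D²(x_1, ..., x_n) + (x_1 + ... + x_n − y − z)² = 0`. -/
def AuxSolSet (n : ℕ) (D : MvPolynomial (Fin n) ℤ) : Set ((Fin n → ℕ) × ℕ × ℕ) :=
  {p | (MvPolynomial.eval (fun i => ((p.1 i : ℤ))) D) ^ 2 +
        ((∑ i, (p.1 i : ℤ)) - (p.2.1 : ℤ) - (p.2.2 : ℤ)) ^ 2 = 0}

theorem stmt_16 (n : ℕ) (D : MvPolynomial (Fin n) ℤ)
    (hfin : {x : Fin n → ℕ | MvPolynomial.eval (fun i => ((x i : ℤ))) D = 0}.Finite) :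
    (AuxSolSet n D).Finite ∧
    ∀ a : Fin n → ℕ, MvPolynomial.eval (fun i => ((a i : ℤ))) D = 0 →
      ∀ i, a i < (AuxSolSet n D).ncard := by
  have key : ∀ p : (Fin n → ℕ) × ℕ × ℕ, p ∈ AuxSolSet n D ↔
      MvPolynomial.eval (fun i => ((p.1 i : ℤ))) D = 0 ∧ ∑ i, p.1 i = p.2.1 + p.2.2 := by
    intro p
    unfold AuxSolSet
    rw [Set.mem_ofPred_eq, ← Nat.cast_inj (R := ℤ)]
    push_cast
    constructor
    · intro h
      constructor
      · nlinarith [sq_nonneg (MvPolynomial.eval (fun i => ((p.1 i : ℤ))) D),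
          sq_nonneg ((∑ i, (p.1 i : ℤ)) - (p.2.1 : ℤ) - (p.2.2 : ℤ))]
      · nlinarith [sq_nonneg (MvPolynomial.eval (fun i => ((p.1 i : ℤ))) D),
          sq_nonneg ((∑ i, (p.1 i : ℤ)) - (p.2.1 : ℤ) - (p.2.2 : ℤ))]
    · rintro ⟨h1, h2⟩
      rw [h1, h2]
      ring
  have hF : (AuxSolSet n D).Finite := by
    refine (hfin.biUnion (t := fun x => (fun q : ℕ × ℕ => (x, q)) ''
      (↑(Finset.HasAntidiagonal.antidiagonal (∑ i, x i)) : Set (ℕ × ℕ)))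
      (fun x _ => (Finset.finite_toSet _).image _)).subset ?_
    rintro ⟨x, y, z⟩ hp
    obtain ⟨h1, h2⟩ := (key _).1 hp
    simp only [Set.mem_iUnion]
    exact ⟨x, h1, (y, z), by simpa using h2.symm, rfl⟩
  refine ⟨hF, fun a ha i => ?_⟩
  have hle : a i ≤ ∑ j, a j :=
    Finset.single_le_sum (f := a) (fun j _ => Nat.zero_le _) (Finset.mem_univ i)
  have hsub : (fun q : ℕ × ℕ => (a, q)) ''
      (↑(Finset.HasAntidiagonal.antidiagonal (∑ i, a i)) : Set (ℕ × ℕ)) ⊆ AuxSolSet n D := by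
    rintro _ ⟨q, hq, rfl⟩
    refine (key _).2 ⟨ha, ?_⟩
    simpa using (Finset.HasAntidiagonal.mem_antidiagonal.1 (Finset.mem_coe.1 hq)).symm
  have hc := Set.ncard_le_ncard hsub hF
  rw [Set.ncard_image_of_injective _ (Prod.mk_right_injective a), Set.ncard_coe_finset,
    Finset.Nat.card_antidiagonal] at hc
  omega
end

section
/- For each integer n ≥ 2, the system of equations in the variables x_1,...,x_{n+11} consisting of: x_i · x_i = x_{i+1} for all i ∈ {1,...,n}; x_{n+2} = 1; x_{n+2} + x_{n+2} = x_{n+3}; x_{n+3} + x_{n+3} = x_{n+4}; x_{n+4} + x_{n+5} = x_{n+6}; x_{n+6} + x_{n+2} = x_1; x_{n+6} · x_{n+6} = x_{n+7}; x_{n+8} + x_{n+8} = x_{n+9}; x_{n+9} + x_{n+2} = x_{n+10}; x_{n+7} · x_{n+10} = x_{n+11}; x_{n+11} + x_{n+2} = x_{n+1}, has a unique solution (a_1,...,a_{n+11}) in non-negative integers; moreover, a_{n+1} > 2^(2^((n+11)−2)) for every integer n ≥ 512. -/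
/-- The system from [IPL], in variables `x 1, ..., x (n+11)` over ℕ. -/
def Solves18 (n : ℕ) (x : ℕ → ℕ) : Prop :=
  (∀ i, 1 ≤ i → i ≤ n → x i * x i = x (i + 1)) ∧
  x (n + 2) = 1 ∧
  x (n + 2) + x (n + 2) = x (n + 3) ∧
  x (n + 3) + x (n + 3) = x (n + 4) ∧
  x (n + 4) + x (n + 5) = x (n + 6) ∧
  x (n + 6) + x (n + 2) = x 1 ∧
  x (n + 6) * x (n + 6) = x (n + 7) ∧
  x (n + 8) + x (n + 8) = x (n + 9) ∧
  x (n + 9) + x (n + 2) = x (n + 10) ∧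
  x (n + 7) * x (n + 10) = x (n + 11) ∧
  x (n + 11) + x (n + 2) = x (n + 1)


lemma pow_form (r k : ℕ) : ∃ v, (4 * r + 1) ^ 2 ^ k = 1 + 2 ^ k * (4 * r) * (2 * v + 1) := by
  induction k with
  | zero => exact ⟨0, by ring⟩
  | succ k ih =>
    obtain ⟨v, hv⟩ := ih
    refine ⟨v + 2 ^ k * r * (2 * v + 1) ^ 2, ?_⟩
    rw [pow_succ 2 k, pow_mul, hv]
    ring

lemma pow_mod_sq (m N : ℕ) : ∃ q, (m + 1) ^ N = 1 + N * m + m ^ 2 * q := by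
  induction N with
  | zero => exact ⟨0, by simp⟩
  | succ N ih =>
    obtain ⟨q, hq⟩ := ih
    refine ⟨N + q * (m + 1), ?_⟩
    rw [pow_succ, hq]
    ring

lemma m_eq (n m k : ℕ) (hm : 4 ≤ m) (h : m * m * (2 * k + 1) + 1 = (m + 1) ^ 2 ^ n) :
    m = 2 ^ n := by
  have hd : m ∣ 2 ^ n := by
    obtain ⟨q, hq⟩ := pow_mod_sq m (2 ^ n)
    have h1 : m * (m * (2 * k + 1)) = m * (2 ^ n + m * q) := by
      rw [hq] at h
      linarith
    have h2 := Nat.eq_of_mul_eq_mul_left (by omega) h1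
    have h3 : m ∣ 2 ^ n + m * q := ⟨_, h2.symm⟩
    exact (Nat.dvd_add_left (dvd_mul_right m q)).1 h3
  obtain ⟨j, hj, rfl⟩ := (Nat.dvd_prime_pow Nat.prime_two).1 hd
  have hj2 : 2 ≤ j := by
    by_contra hc
    have : j = 0 ∨ j = 1 := by omega
    rcases this with rfl | rfl <;> norm_num at hm
  obtain ⟨i, rfl⟩ := Nat.exists_eq_add_of_le hj2
  obtain ⟨v, hv⟩ := pow_form (2 ^ i) n
  have e : 2 ^ (2 + i) = 4 * 2 ^ i := by ring
  rw [← e] at hv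
  rw [hv] at h
  have h1 : 2 ^ (2 + i) * (2 ^ (2 + i) * (2 * k + 1)) = 2 ^ (2 + i) * (2 ^ n * (2 * v + 1)) := by
    linarith
  have h2 := Nat.eq_of_mul_eq_mul_left (by positivity) h1
  have h3 : 2 ^ n ∣ 2 ^ (2 + i) * (2 * k + 1) := ⟨_, h2⟩
  have hc : Nat.Coprime (2 ^ n) (2 * k + 1) := by
    apply Nat.Coprime.pow_left
    simp
  exact Nat.dvd_antisymm hd (hc.dvd_of_dvd_mul_right h3)

lemma chain (n : ℕ) (x : ℕ → ℕ) (h : ∀ i, 1 ≤ i → i ≤ n → x i * x i = x (i + 1)) :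
    ∀ i, i ≤ n → x (i + 1) = x 1 ^ 2 ^ i := by
  intro i
  induction i with
  | zero => simp
  | succ i ih =>
    intro hi
    rw [← h (i + 1) (by omega) hi, ih (by omega), pow_succ 2 i, pow_mul]
    ring

/-- The values of the solution after index `n + 1`. -/
def tail18 (n v : ℕ) : ℕ → ℕ
  | 2 => 1
  | 3 => 2
  | 4 => 4
  | 5 => 2 ^ n - 4
  | 6 => 2 ^ n
  | 7 => 2 ^ n * 2 ^ n
  | 8 => v
  | 9 => 2 * v
  | 10 => 2 * v + 1
  | _ => 2 ^ n * 2 ^ n * (2 * v + 1)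

theorem stmt_18 (n : ℕ) (hn : 2 ≤ n) :
    ∃ a : ℕ → ℕ, Solves18 n a ∧
      (∀ b : ℕ → ℕ, Solves18 n b → ∀ i, 1 ≤ i → i ≤ n + 11 → b i = a i) ∧
      (512 ≤ n → 2 ^ 2 ^ (n + 11 - 2) < a (n + 1)) := by
  have h4 : 4 ≤ 2 ^ n := by
    calc 4 = 2 ^ 2 := by norm_num
      _ ≤ 2 ^ n := Nat.pow_le_pow_right (by norm_num) hn
  obtain ⟨v, hv⟩ : ∃ v, (2 ^ n + 1) ^ 2 ^ n = 1 + 2 ^ n * 2 ^ n * (2 * v + 1) := by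
    obtain ⟨i, hi⟩ := Nat.exists_eq_add_of_le hn
    obtain ⟨v, hv⟩ := pow_form (2 ^ i) n
    have e : 4 * 2 ^ i = 2 ^ n := by rw [hi]; ring
    rw [e] at hv
    exact ⟨v, hv⟩
  let a : ℕ → ℕ := fun i => if i ≤ n + 1 then (2 ^ n + 1) ^ 2 ^ (i - 1) else tail18 n v (i - n)
  have ha : ∀ i, i ≤ n → a (i + 1) = (2 ^ n + 1) ^ 2 ^ i := by
    intro i hi
    simp [a, hi]
  have ht : ∀ j, 2 ≤ j → a (n + j) = tail18 n v j := by
    intro j hj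
    have : ¬ (n + j ≤ n + 1) := by omega
    simp only [a, if_neg this]
    congr 1
    omega
  refine ⟨a, ?_, ?_, ?_⟩
  · refine ⟨?_, ?_⟩
    · intro i h1 h2
      obtain ⟨j, rfl⟩ := Nat.exists_eq_add_of_le' h1
      rw [ha j (by omega), ha (j + 1) h2, pow_succ 2 j, pow_mul]
      ring
    · have h1 := ha 0 (by omega)
      rw [zero_add] at h1
      rw [h1, ha n le_rfl, ht 2 (by omega), ht 3 (by omega), ht 4 (by omega), ht 5 (by omega),
        ht 6 (by omega), ht 7 (by omega), ht 8 (by omega), ht 9 (by omega), ht 10 (by omega),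
        ht 11 (by omega), hv]
      simp only [tail18]
      refine ⟨trivial, by norm_num, by norm_num, by omega, by simp, trivial, by ring, trivial,
        trivial, by ring⟩
  · rintro b ⟨hb, b2, b3, b4, b5, b6, b7, b8, b9, b10, b11⟩
    have hc := chain n b hb
    have hb1 : b 1 = b (n + 6) + 1 := by omega
    have hm : b (n + 6) = 2 ^ n := by
      apply m_eq n _ (b (n + 8)) (by omega)
      rw [← hb1, ← hc n le_rfl, ← b11, ← b10, ← b9, ← b8, ← b7, b2, two_mul]
    have hv8 : b (n + 8) = v := by
      have e := hc n le_rfl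
      rw [hb1, hm, hv, ← b11, b2, ← b10, ← b7, ← b9, ← b8, hm, b2] at e
      have e2 : 2 ^ n * 2 ^ n * (b (n + 8) + b (n + 8) + 1) = 2 ^ n * 2 ^ n * (2 * v + 1) := by
        omega
      have := Nat.eq_of_mul_eq_mul_left (by positivity) e2
      omega
    intro i h1 h2
    by_cases hi : i ≤ n + 1
    · obtain ⟨j, rfl⟩ := Nat.exists_eq_add_of_le' h1
      rw [ha j (by omega), hc j (by omega), hb1, hm]
    · obtain ⟨j, rfl⟩ := Nat.exists_eq_add_of_le (show n ≤ i by omega)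
      rw [ht j (by omega)]
      have hj2 : 2 ≤ j := by omega
      have hj11 : j ≤ 11 := by omega
      have h10 : b (n + 10) = 2 * v + 1 := by omega
      have h7 : b (n + 7) = 2 ^ n * 2 ^ n := by rw [← b7, hm]
      have h11 : b (n + 11) = 2 ^ n * 2 ^ n * (2 * v + 1) := by rw [← b10, h7, h10]
      clear hb hc ha ht
      interval_cases j <;> simp only [tail18] <;> first | assumption | omega
  · intro h
    rw [ha n le_rfl]
    have e : n + 11 - 2 = 9 + n := by omega
    rw [e, pow_add 2 9 n, pow_mul]
    apply Nat.pow_lt_pow_left _ (by positivity)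
    have : 2 ^ 2 ^ 9 ≤ 2 ^ n := Nat.pow_le_pow_right (by norm_num) (by norm_num; exact h)
    exact Nat.lt_succ_of_le this
end
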